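/- In a graphical matching problem instance whose player graph is symmetric, every improvement path is finite; that is, there is no infinite sequence of allocations π⁰, π¹, π², ... such that for each k ≥ 1, π^{k-1} →_{i,j} π^k is a blocking-pair resolution for some pair of players i, j. -/

import Mathlib

open scoped Classical

/-- A graphical matching problem instance: a player graph `(tau, w)` on players `N`
(no self-loops), an item graph `lam` on items `A` (symmetric, irreflexive), and
nonnegative valuations `v`. -/
structure GMP (N A : Type*) [Fintype N] [Fintype A] where
  tau : N → N → Prop
  w : N → N → ℝ
  noSelf : ∀ i, ¬ tau i i
  lam : A → A → Prop
  lamSymm : ∀ a b, lam a b → lam b a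
  lamIrrefl : ∀ a, ¬ lam a a
  v : N → A → ℝ
  vNonneg : ∀ i a, 0 ≤ v i a

variable {N A : Type*} [Fintype N] [Fintype A]

/-- The utility of player `i` under allocation `π`. -/
noncomputable def GMP.utility (M : GMP N A) (π : N ≃ A) (i : N) : ℝ :=
  M.v i (π i) +
    ∑ j ∈ Finset.univ.filter (fun j => M.tau j i ∧ M.lam (π j) (π i)), M.w j i

/-- The allocation obtained from `π` by swapping the items of `i` and `j`. -/
noncomputable def swapAlloc (π : N ≃ A) (i j : N) : N ≃ A := (Equiv.swap i j).trans π

/-- `(i, j)` is a blocking pair in `π`. -/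
def GMP.BlockingPair (M : GMP N A) (π : N ≃ A) (i j : N) : Prop :=
  i ≠ j ∧ M.utility π i < M.utility (swapAlloc π i j) i ∧
    M.utility π j < M.utility (swapAlloc π i j) j

/-- An allocation is 2-stable if it has no blocking pair. -/
def GMP.TwoStable (M : GMP N A) (π : N ≃ A) : Prop :=
  ∀ i j, ¬ M.BlockingPair π i j

/-- The player graph is symmetric. -/
def GMP.Symm (M : GMP N A) : Prop :=
  ∀ i j, M.tau i j → M.tau j i ∧ M.w i j = M.w j i

/-- The potential function `φ(π) = Σ_i (v_i(π(i)) + u_i(π))`. -/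
noncomputable def GMP.phi (M : GMP N A) (π : N ≃ A) : ℝ :=
  ∑ i, (M.v i (π i) + M.utility π i)

/-- Social welfare. -/
noncomputable def GMP.SW (M : GMP N A) (π : N ≃ A) : ℝ :=
  ∑ i, M.utility π i

/-- `X` is a blocking coalition in `π` witnessed by `π'`. -/
def GMP.BlocksVia (M : GMP N A) (π : N ≃ A) (X : Finset N) (π' : N ≃ A) : Prop :=
  X.Nonempty ∧ ∃ μ : N → N, Set.BijOn μ ↑X ↑X ∧
    (∀ k, k ∉ X → π' k = π k) ∧
    ∀ i ∈ X, π' i = π (μ i) ∧ π' i ≠ π i ∧ M.utility π i < M.utility π' i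

/-- `X` is a blocking coalition in `π`. -/
def GMP.BlockingCoalition (M : GMP N A) (π : N ≃ A) (X : Finset N) : Prop :=
  ∃ π' : N ≃ A, M.BlocksVia π X π'

/-- An allocation is core stable if it has no blocking coalition. -/
def GMP.CoreStable (M : GMP N A) (π : N ≃ A) : Prop :=
  ∀ X : Finset N, ¬ M.BlockingCoalition π X

/-- An allocation is envy-free if no player strictly gains from a (unilateral) swap. -/
def GMP.EnvyFree (M : GMP N A) (π : N ≃ A) : Prop :=
  ∀ i j, ¬ M.utility π i < M.utility (swapAlloc π i j) i

/-- The contribution of player `j` to the utility of player `i` under `π`. -/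
noncomputable def GMP.contribution (M : GMP N A) (π : N ≃ A) (j i : N) : ℝ :=
  if M.tau j i ∧ M.lam (π j) (π i) then M.w j i else 0

theorem GMP.utility_eq_add_sum_contribution (M : GMP N A) (π : N ≃ A) (i : N) :
    M.utility π i = M.v i (π i) + ∑ j, M.contribution π j i := by
  simp only [GMP.utility, GMP.contribution, Finset.sum_filter]

theorem GMP.contribution_self (M : GMP N A) (π : N ≃ A) (i : N) :
    M.contribution π i i = 0 :=
  if_neg fun h => M.noSelf i h.1

theorem GMP.Symm.contribution_comm {M : GMP N A} (h : M.Symm) (π : N ≃ A) (i j : N) :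
    M.contribution π i j = M.contribution π j i := by
  unfold GMP.contribution
  by_cases hij : M.tau i j ∧ M.lam (π i) (π j)
  · rw [if_pos hij, if_pos ⟨(h i j hij.1).1, M.lamSymm _ _ hij.2⟩, (h i j hij.1).2]
  · rw [if_neg hij, if_neg fun hji => hij ⟨(h j i hji.1).1, M.lamSymm _ _ hji.2⟩]

theorem swapAlloc_apply_left {N A : Type*} (π : N ≃ A) (i j : N) : swapAlloc π i j i = π j := by
  simp [swapAlloc]

theorem swapAlloc_apply_right {N A : Type*} (π : N ≃ A) (i j : N) : swapAlloc π i j j = π i := by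
  simp [swapAlloc]

theorem swapAlloc_apply_of_ne {N A : Type*} (π : N ≃ A) {i j k : N} (hi : k ≠ i) (hj : k ≠ j) :
    swapAlloc π i j k = π k := by
  simp [swapAlloc, Equiv.swap_apply_of_ne_of_ne hi hj]

theorem GMP.Symm.contribution_swapAlloc {M : GMP N A} (h : M.Symm) (π : N ≃ A) (i j : N) :
    M.contribution (swapAlloc π i j) i j = M.contribution π i j := by
  rw [h.contribution_comm π]
  unfold GMP.contribution
  rw [swapAlloc_apply_left, swapAlloc_apply_right]
  by_cases hij : M.tau i j ∧ M.lam (π j) (π i)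
  · rw [if_pos hij, if_pos ⟨(h i j hij.1).1, hij.2⟩, (h i j hij.1).2]
  · rw [if_neg hij, if_neg fun hji => hij ⟨(h j i hji.1).1, hji.2⟩]

/-- The total of a symmetric matrix supported on two crossing rows and columns. -/
theorem sum_sum_eq_of_support_pair (D : N → N → ℝ) {i j : N} (hne : i ≠ j)
    (hsymm : ∀ a b, D a b = D b a) (hdiag : ∀ a, D a a = 0) (hij : D i j = 0)
    (hsupp : ∀ a b, a ≠ i → a ≠ j → b ≠ i → b ≠ j → D a b = 0) :
    ∑ a, ∑ b, D b a = 2 * (∑ b, D b i + ∑ b, D b j) := by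
  have key : ∀ a b, D b a = (if a = i then D b i else 0) + (if a = j then D b j else 0) +
      ((if b = i then D a i else 0) + (if b = j then D a j else 0)) := by
    intro a b
    have := hsymm i j
    have := hsymm a b
    have := hsupp b a
    have := hdiag i
    have := hdiag j
    split_ifs <;> grind
  have hrows : ∀ k : N, ∑ a, ∑ b, (if a = k then D b k else 0) = ∑ b, D b k := by
    intro k
    rw [Finset.sum_comm]
    simp
  rw [Finset.sum_congr rfl fun a _ => Finset.sum_congr rfl fun b _ => key a b]
  simp only [Finset.sum_add_distrib, hrows, Finset.sum_ite_eq', Finset.mem_univ, if_true]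
  ring

theorem sum_swap_sub {N A : Type*} [Fintype N] (v : N → A → ℝ) (π : N ≃ A) {i j : N} (hne : i ≠ j) :
    ∑ k, (v k (swapAlloc π i j k) - v k (π k)) =
      (v i (swapAlloc π i j i) - v i (π i)) + (v j (swapAlloc π i j j) - v j (π j)) := by
  rw [← Finset.sum_pair (f := fun k => v k (swapAlloc π i j k) - v k (π k)) hne]
  refine (Finset.sum_subset (Finset.subset_univ _) fun k _ hk => ?_).symm
  simp only [Finset.mem_insert, Finset.mem_singleton, not_or] at hk
  rw [swapAlloc_apply_of_ne π hk.1 hk.2, sub_self]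

/-- A swap changes the potential by twice the total change in utility of the swapped players. -/
theorem GMP.Symm.phi_swapAlloc_sub {M : GMP N A} (h : M.Symm) (π : N ≃ A) {i j : N}
    (hne : i ≠ j) :
    M.phi (swapAlloc π i j) - M.phi π =
      2 * ((M.utility (swapAlloc π i j) i - M.utility π i) +
        (M.utility (swapAlloc π i j) j - M.utility π j)) := by
  have hc := sum_sum_eq_of_support_pair
    (fun a b => M.contribution (swapAlloc π i j) a b - M.contribution π a b) hne
    (fun a b => by rw [h.contribution_comm _ a b, h.contribution_comm π a b])
    (fun a => by rw [M.contribution_self, M.contribution_self, sub_self])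
    (by rw [h.contribution_swapAlloc, sub_self])
    (fun a b hai haj hbi hbj => by
      simp only [GMP.contribution, swapAlloc_apply_of_ne π hai haj,
        swapAlloc_apply_of_ne π hbi hbj, sub_self])
  have hv := sum_swap_sub M.v π hne
  simp only [Finset.sum_sub_distrib] at hc hv
  simp only [GMP.phi, GMP.utility_eq_add_sum_contribution, Finset.sum_add_distrib]
  linarith

theorem GMP.Symm.phi_lt_phi_swapAlloc {M : GMP N A} (h : M.Symm) {π : N ≃ A} {i j : N}
    (hb : M.BlockingPair π i j) : M.phi π < M.phi (swapAlloc π i j) := by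
  have := h.phi_swapAlloc_sub π hb.1
  linarith [hb.2.1, hb.2.2]

/-- In a symmetric GMP instance every improvement path is finite:
there is no infinite sequence of allocations in which every consecutive pair is a
blocking-pair resolution. -/
theorem stmt1 {N A : Type*} [Fintype N] [Fintype A] (M : GMP N A) (hsym : M.Symm) :
    ¬ ∃ f : ℕ → N ≃ A, ∀ k : ℕ, ∃ i j : N,
        M.BlockingPair (f k) i j ∧ f (k + 1) = swapAlloc (f k) i j := by
  rintro ⟨f, hf⟩
  have hmono : StrictMono fun k => M.phi (f k) := strictMono_nat_of_lt_succ fun k => by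
    obtain ⟨i, j, hb, he⟩ := hf k
    rw [he]
    exact hsym.phi_lt_phi_swapAlloc hb
  exact not_injective_infinite_finite f (Function.Injective.of_comp (f := M.phi) hmono.injective)
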